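/- Let u_ε be a classical solution of the regularized anisotropic problem with ε ∈ (0,ε₀], satisfying |u_ε| ≤ M on Q̄_T, and suppose F satisfies the monotonicity condition F(x,u,z) ≤ F(x,v,z) whenever u ≥ v. Then in the closed prism P̄ = {(t,τ,x) : t ∈ [0,T], τ ∈ [0,T], x ∈ Ω̄, t ≥ τ} one has u_ε(t,x) − u_ε(τ,x) ≤ K(t−τ), where K is the constant defined in the context. -/

import Mathlib

open Set Filter MeasureTheory Metric

noncomputable section

/-- The `i`-th partial derivative of a function on Euclidean space. -/
def pd {n : ℕ} (f : EuclideanSpace ℝ (Fin n) → ℝ) (i : Fin n)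
    (x : EuclideanSpace ℝ (Fin n)) : ℝ :=
  fderiv ℝ f x (EuclideanSpace.single i 1)

/-- The gradient vector of a function on Euclidean space. -/
def gradv {n : ℕ} (f : EuclideanSpace ℝ (Fin n) → ℝ)
    (x : EuclideanSpace ℝ (Fin n)) : EuclideanSpace ℝ (Fin n) :=
  (WithLp.equiv 2 (Fin n → ℝ)).symm (fun i => pd f i x)

/-- The exterior sphere condition for a domain. -/
def ExteriorSphereCond {n : ℕ} (Ω : Set (EuclideanSpace ℝ (Fin n))) : Prop :=
  ∀ y ∈ frontier Ω, ∃ z r, 0 < r ∧ closedBall z r ∩ closure Ω = {y}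

/-- `f` is of class `C^{1+γ}` on `s` (C¹ with γ-Hölder continuous derivative). -/
def C1HolderOn {n : ℕ} (γ : ℝ) (s : Set (EuclideanSpace ℝ (Fin n)))
    (f : EuclideanSpace ℝ (Fin n) → ℝ) : Prop :=
  ContDiffOn ℝ 1 f s ∧
    ∃ C : NNReal, HolderOnWith C γ.toNNReal (fun x => fderivWithin ℝ f s x) s

/-- Classical solution of the regularized anisotropic problem
`u_t = ∑ᵢ ((u_{xᵢ}² + ε)^{pᵢ(x)/2} u_{xᵢ})_{xᵢ} + F(x, u, ∇u)` in `Q_T = (0,T) × Ω`,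
with `u = ψ` on `∂Ω × (0,T)` and `u(0,·) = u₀` in `Ω`. -/
structure IsClassicalSolAniso {n : ℕ} (Ω : Set (EuclideanSpace ℝ (Fin n))) (T : ℝ)
    (p : Fin n → EuclideanSpace ℝ (Fin n) → ℝ)
    (F : EuclideanSpace ℝ (Fin n) → ℝ → EuclideanSpace ℝ (Fin n) → ℝ)
    (ψ u₀ : EuclideanSpace ℝ (Fin n) → ℝ) (ε : ℝ)
    (u : ℝ → EuclideanSpace ℝ (Fin n) → ℝ) : Prop where
  cont : ContinuousOn (fun q : ℝ × EuclideanSpace ℝ (Fin n) => u q.1 q.2)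
      (Icc 0 T ×ˢ closure Ω)
  diff_t : ∀ t ∈ Ioo 0 T, ∀ x ∈ Ω, DifferentiableAt ℝ (fun s => u s x) t
  smooth_x : ∀ t ∈ Ioo 0 T, ∀ x ∈ Ω, ContDiffAt ℝ 2 (u t) x
  cont_ut : ContinuousOn
      (fun q : ℝ × EuclideanSpace ℝ (Fin n) => deriv (fun s => u s q.2) q.1) (Ioo 0 T ×ˢ Ω)
  cont_ux : ∀ i, ContinuousOn
      (fun q : ℝ × EuclideanSpace ℝ (Fin n) => pd (u q.1) i q.2) (Ioo 0 T ×ˢ Ω)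
  cont_uxx : ∀ i j, ContinuousOn
      (fun q : ℝ × EuclideanSpace ℝ (Fin n) => pd (fun y => pd (u q.1) j y) i q.2)
      (Ioo 0 T ×ˢ Ω)
  eqn : ∀ t ∈ Ioo 0 T, ∀ x ∈ Ω,
      deriv (fun s => u s x) t =
        (∑ i, pd (fun y => ((pd (u t) i y) ^ 2 + ε) ^ (p i y / 2) * pd (u t) i y) i x)
          + F x (u t x) (gradv (u t) x)
  bdry : ∀ t ∈ Ioo 0 T, ∀ x ∈ frontier Ω, u t x = ψ x
  init : ∀ x ∈ closure Ω, u 0 x = u₀ x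

lemma differentiableAt_pd {n : ℕ} {f : EuclideanSpace ℝ (Fin n) → ℝ}
    {x : EuclideanSpace ℝ (Fin n)} (hf : ContDiffAt ℝ 2 f x) (i : Fin n) :
    DifferentiableAt ℝ (fun y => pd f i y) x :=
  ((hf.fderiv_right (m := 1) (by norm_num)).differentiableAt (by simp)).clm_apply
    (differentiableAt_const _)

/-- Second-order necessary condition for a local maximum along a coordinate direction. -/
lemma pd_pd_nonpos_of_isLocalMax {n : ℕ} {w : EuclideanSpace ℝ (Fin n) → ℝ}
    {x : EuclideanSpace ℝ (Fin n)} (hw : ContDiffAt ℝ 2 w x) (hmax : IsLocalMax w x)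
    (i : Fin n) : pd (fun y => pd w i y) i x ≤ 0 := by
  set e : EuclideanSpace ℝ (Fin n) := EuclideanSpace.single i 1 with he
  have hline : ∀ s : ℝ, HasDerivAt (fun s : ℝ => x + s • e) e s := fun s => by
    simpa using ((hasDerivAt_id s).smul_const e).const_add x
  have hx0 : x + (0 : ℝ) • e = x := by simp
  have htend : Tendsto (fun s : ℝ => x + s • e) (nhds 0) (nhds x) := by
    simpa using (hline 0).continuousAt.tendsto
  have hdiff : ∀ᶠ y in nhds x, DifferentiableAt ℝ w y := by
    filter_upwards [hw.eventually (by simp)] with y hy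
    exact hy.differentiableAt (by simp)
  have hderiv : deriv (fun s : ℝ => w (x + s • e)) =ᶠ[nhds 0]
      fun s => fderiv ℝ w (x + s • e) e := by
    filter_upwards [htend.eventually hdiff] with s hs
    exact (hs.hasFDerivAt.comp_hasDerivAt s (hline s)).deriv
  have hpd : HasFDerivAt (fun y => pd w i y) (fderiv ℝ (fun y => pd w i y) x) x :=
    (differentiableAt_pd hw i).hasFDerivAt
  have hsecond : deriv (deriv fun s : ℝ => w (x + s • e)) 0 = pd (fun y => pd w i y) i x := by
    rw [hderiv.deriv_eq]
    exact (HasFDerivAt.comp_hasDerivAt_of_eq (0 : ℝ) hpd (hline 0) hx0.symm).deriv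
  by_contra! hpos
  have hlmax : IsLocalMax (fun s : ℝ => w (x + s • e)) 0 := by
    have := htend.eventually hmax
    filter_upwards [this] with s hs
    simpa using hs
  have hcont : ContinuousAt (fun s : ℝ => w (x + s • e)) 0 :=
    ContinuousAt.comp_of_eq hw.continuousAt (hline 0).continuousAt hx0
  have hlmin := isLocalMin_of_deriv_deriv_pos (hsecond ▸ hpos) hlmax.deriv_eq_zero hcont
  have hconst : (fun s : ℝ => w (x + s • e)) =ᶠ[nhds 0] fun _ => w (x + (0 : ℝ) • e) := by
    filter_upwards [hlmax, hlmin] with s h1 h2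
    exact le_antisymm h1 h2
  have hzero : deriv (deriv fun s : ℝ => w (x + s • e)) 0 = 0 := by
    rw [hconst.deriv.deriv_eq]
    simp
  linarith

/-- At a local maximum of a difference, the first partial derivatives agree. -/
lemma pd_eq_of_isLocalMax_sub {n : ℕ} {f g : EuclideanSpace ℝ (Fin n) → ℝ}
    {x : EuclideanSpace ℝ (Fin n)} (hf : DifferentiableAt ℝ f x) (hg : DifferentiableAt ℝ g x)
    (hmax : IsLocalMax (fun y => f y - g y) x) (i : Fin n) : pd f i x = pd g i x := by
  have h := hmax.fderiv_eq_zero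
  rw [fderiv_fun_sub hf hg, sub_eq_zero] at h
  simp only [pd, h]

lemma pd_pd_le_of_isLocalMax_sub {n : ℕ} {f g : EuclideanSpace ℝ (Fin n) → ℝ}
    {x : EuclideanSpace ℝ (Fin n)} (hf : ContDiffAt ℝ 2 f x) (hg : ContDiffAt ℝ 2 g x)
    (hmax : IsLocalMax (fun y => f y - g y) x) (i : Fin n) :
    pd (fun y => pd f i y) i x ≤ pd (fun y => pd g i y) i x := by
  have h := pd_pd_nonpos_of_isLocalMax (hf.sub hg) hmax i
  have heq : (fun y => pd (f - g) i y) =ᶠ[nhds x] fun y => pd f i y - pd g i y := by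
    filter_upwards [hf.eventually (by simp), hg.eventually (by simp)] with y hfy hgy
    simp only [pd]
    rw [fderiv_sub (hfy.differentiableAt (by simp)) (hgy.differentiableAt (by simp))]
    rfl
  have h' : pd (fun y => pd (f - g) i y) i x =
      pd (fun y => pd f i y) i x - pd (fun y => pd g i y) i x := by
    rw [pd, heq.fderiv_eq, fderiv_fun_sub (differentiableAt_pd hf i) (differentiableAt_pd hg i)]
    rfl
  change pd (fun y => pd (f - g) i y) i x ≤ 0 at h
  linarith

/-- Product and chain rule for the regularized anisotropic flux. -/
lemma pd_flux {n : ℕ} {g q : EuclideanSpace ℝ (Fin n) → ℝ} {x : EuclideanSpace ℝ (Fin n)}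
    {ε : ℝ} (hε : 0 < ε) (hg : DifferentiableAt ℝ g x) (hq : DifferentiableAt ℝ q x)
    (i : Fin n) :
    pd (fun y => (g y ^ 2 + ε) ^ (q y / 2) * g y) i x =
      (g x ^ 2 + ε) ^ (q x / 2 - 1) * ((q x + 1) * g x ^ 2 + ε) * pd g i x +
        (g x ^ 2 + ε) ^ (q x / 2) * Real.log (g x ^ 2 + ε) * g x / 2 * pd q i x := by
  have hpos : 0 < g x ^ 2 + ε := by positivity
  have h2 : HasFDerivAt (fun y => q y / 2) ((2 : ℝ)⁻¹ • fderiv ℝ q x) x := by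
    simpa [div_eq_inv_mul] using hq.hasFDerivAt.const_mul (2 : ℝ)⁻¹
  have h3 := (((hg.hasFDerivAt.pow 2).add_const ε).rpow h2 hpos).mul hg.hasFDerivAt
  have hfd := h3.fderiv
  have hsplit : (g x ^ 2 + ε) ^ (q x / 2) =
      (g x ^ 2 + ε) ^ (q x / 2 - 1) * (g x ^ 2 + ε) := by
    rw [Real.rpow_sub_one hpos.ne']
    field_simp
  change fderiv ℝ (fun y => (g y ^ 2 + ε) ^ (q y / 2) * g y) x _ = _
  erw [hfd]
  simp [pd]
  rw [hsplit]
  ring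

/-- Ellipticity: the anisotropic operator is ordered at a local maximum of a difference. -/
lemma sum_pd_flux_le_of_isLocalMax_sub {n : ℕ} {f g : EuclideanSpace ℝ (Fin n) → ℝ}
    {p : Fin n → EuclideanSpace ℝ (Fin n) → ℝ} {x : EuclideanSpace ℝ (Fin n)} {ε : ℝ}
    (hε : 0 < ε) (hf : ContDiffAt ℝ 2 f x) (hg : ContDiffAt ℝ 2 g x)
    (hp : ∀ i, DifferentiableAt ℝ (p i) x) (hp1 : ∀ i, -1 < p i x)
    (hmax : IsLocalMax (fun y => f y - g y) x) :
    ∑ i, pd (fun y => ((pd f i y) ^ 2 + ε) ^ (p i y / 2) * pd f i y) i x ≤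
      ∑ i, pd (fun y => ((pd g i y) ^ 2 + ε) ^ (p i y / 2) * pd g i y) i x := by
  refine Finset.sum_le_sum fun i _ => ?_
  rw [pd_flux hε (differentiableAt_pd hf i) (hp i) i,
    pd_flux hε (differentiableAt_pd hg i) (hp i) i,
    pd_eq_of_isLocalMax_sub (hf.differentiableAt (by simp)) (hg.differentiableAt (by simp)) hmax i]
  have h1 : 0 < p i x + 1 := by linarith [hp1 i]
  gcongr
  exact pd_pd_le_of_isLocalMax_sub hf hg hmax i

/-- Parabolic maximum principle: a function bounded by `c` on the parabolic boundary, whose time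
derivative is nonpositive at every spatial local maximum above the level `c`, stays below `c`. -/
lemma le_of_parabolic_boundary_le {E : Type*} [NormedAddCommGroup E] [NormedSpace ℝ E]
    [ProperSpace E] {Ω : Set E} (hΩo : IsOpen Ω) (hΩbd : Bornology.IsBounded Ω) {S c : ℝ}
    {w : ℝ → E → ℝ}
    (hcont : ContinuousOn (fun q : ℝ × E => w q.1 q.2) (Icc 0 S ×ˢ closure Ω))
    (hdiff : ∀ t ∈ Ioo 0 S, ∀ x ∈ Ω, DifferentiableAt ℝ (fun s => w s x) t)
    (hinit : ∀ x ∈ closure Ω, w 0 x ≤ c)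
    (hbdry : ∀ t ∈ Ioo 0 S, ∀ x ∈ frontier Ω, w t x ≤ c)
    (hmax : ∀ t ∈ Ioo 0 S, ∀ x ∈ Ω, IsLocalMax (w t) x → c < w t x →
      deriv (fun s => w s x) t ≤ 0) :
    ∀ t ∈ Icc 0 S, ∀ x ∈ closure Ω, w t x ≤ c := by
  have key : ∀ t ∈ Ioo 0 S, ∀ x ∈ closure Ω, w t x ≤ c := by
    intro t ht x hx
    by_contra! hlt
    obtain ⟨δ, hδ, hδt⟩ : ∃ δ > 0, c < w t x - δ * t := by
      refine ⟨(w t x - c) / (2 * t), by have := ht.1; have := sub_pos.2 hlt; positivity, ?_⟩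
      have := ht.1
      have : (w t x - c) / (2 * t) * t = (w t x - c) / 2 := by field_simp
      linarith
    have hsub : Icc 0 t ×ˢ closure Ω ⊆ Icc 0 S ×ˢ closure Ω :=
      prod_mono (Icc_subset_Icc_right ht.2.le) subset_rfl
    obtain ⟨⟨r, y⟩, ⟨hr, hy⟩, hM⟩ := (isCompact_Icc.prod hΩbd.isCompact_closure).exists_isMaxOn
      ⟨(t, x), ⟨⟨ht.1.le, le_rfl⟩, hx⟩⟩
      (f := fun q : ℝ × E => w q.1 q.2 - δ * q.1)
      ((hcont.mono hsub).sub (by fun_prop))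
    have hM' : ∀ s ∈ Icc 0 t, ∀ z ∈ closure Ω, w s z - δ * s ≤ w r y - δ * r :=
      fun s hs z hz => hM (show (s, z) ∈ Icc 0 t ×ˢ closure Ω from ⟨hs, hz⟩)
    simp only at hr hy
    have hcw : c < w r y := by
      have h1 := hM' t ⟨ht.1.le, le_rfl⟩ x hx
      have h2 := mul_nonneg hδ.le hr.1
      linarith
    have hr0 : 0 < r := by
      refine hr.1.lt_of_ne fun h => ?_
      have := hinit y hy
      rw [h] at this
      linarith
    have hrS : r ∈ Ioo 0 S := ⟨hr0, hr.2.trans_lt ht.2⟩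
    have hyΩ : y ∈ Ω := by
      by_contra hn
      have := hbdry r hrS y (by rw [hΩo.frontier_eq]; exact ⟨hy, hn⟩)
      linarith
    have hloc : IsLocalMax (w r) y := by
      filter_upwards [hΩo.mem_nhds hyΩ] with z hz
      linarith [hM' r hr z (subset_closure hz)]
    have hd := hmax r hrS y hyΩ hloc hcw
    have hhas : HasDerivAt (fun s => w s y - δ * s) (deriv (fun s => w s y) r - δ) r := by
      simpa using (hdiff r hrS y hyΩ).hasDerivAt.fun_sub ((hasDerivAt_id r).const_mul δ)
    have hge : 0 ≤ deriv (fun s => w s y) r - δ := by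
      refine ge_of_tendsto ((hasDerivWithinAt_iff_tendsto_slope' (s := Iio r) (by simp)).1
        hhas.hasDerivWithinAt) ?_
      filter_upwards [Ioo_mem_nhdsLT hr0] with s hs
      rw [slope_def_field]
      have := hM' s ⟨hs.1.le, hs.2.le.trans hr.2⟩ y hy
      exact div_nonneg_of_nonpos (by linarith) (by linarith [hs.2])
    linarith
  intro t ht x hx
  rcases ht.1.eq_or_lt with rfl | ht0
  · exact hinit x hx
  have hSx : ContinuousOn (fun s => w s x) (Icc 0 S) :=
    hcont.comp (f := fun s : ℝ => (s, x)) (by fun_prop) fun s hs => ⟨hs, hx⟩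
  have hct : ContinuousOn (fun s => w s x) (closure (Ioo 0 S)) := by
    rwa [closure_Ioo (ht0.trans_le ht.2).ne]
  refine le_on_closure (fun s hs => key s hs x hx) hct continuousOn_const ?_
  rwa [closure_Ioo (ht0.trans_le ht.2).ne]

theorem stmt3
    (n : ℕ) (hn : 0 < n)
    (Ω : Set (EuclideanSpace ℝ (Fin n)))
    (hΩo : IsOpen Ω) (hΩconn : IsConnected Ω)
    (hΩbd : Bornology.IsBounded Ω) (hΩsph : ExteriorSphereCond Ω)
    (T : ℝ) (hT : 0 < T)
    (γ : ℝ) (hγ : γ ∈ Ioo (0:ℝ) 1)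
    (p : Fin n → EuclideanSpace ℝ (Fin n) → ℝ)
    (hp : ∀ i, C1HolderOn γ (closure Ω) (p i))
    (hp1 : ∀ i, ∀ x ∈ closure Ω, -1 < p i x)
    (ε₀ : ℝ) (hε₀ : 0 < ε₀)
    (F : EuclideanSpace ℝ (Fin n) → ℝ → EuclideanSpace ℝ (Fin n) → ℝ)
    (hF : ContinuousOn
      (fun q : EuclideanSpace ℝ (Fin n) × ℝ × EuclideanSpace ℝ (Fin n) => F q.1 q.2.1 q.2.2)
      (closure Ω ×ˢ (univ : Set (ℝ × EuclideanSpace ℝ (Fin n)))))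
    (hFmono : ∀ x ∈ closure Ω, ∀ v w : ℝ, ∀ z : EuclideanSpace ℝ (Fin n),
      w ≤ v → F x v z ≤ F x w z)
    (ψ u₀ : EuclideanSpace ℝ (Fin n) → ℝ)
    (U : Set (EuclideanSpace ℝ (Fin n))) (hU : IsOpen U) (hUΩ : closure Ω ⊆ U)
    (hu₀ : ContDiffOn ℝ 2 u₀ U)
    (hu₀ψ : ∀ x ∈ frontier Ω, u₀ x = ψ x)
    (M : ℝ) (hM : 0 < M)
    (ε : ℝ) (hε : ε ∈ Ioc (0:ℝ) ε₀)
    (u : ℝ → EuclideanSpace ℝ (Fin n) → ℝ)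
    (hu : IsClassicalSolAniso Ω T p F ψ u₀ ε u)
    (hub : ∀ t ∈ Icc 0 T, ∀ x ∈ closure Ω, |u t x| ≤ M)
    (A B K : ℝ)
    (hA : IsLUB {a : ℝ | ∃ ε' ∈ Icc (0:ℝ) ε₀, ∃ x ∈ closure Ω,
      a = |∑ i, pd (fun y => ((pd u₀ i y) ^ 2 + ε') ^ (p i y / 2) * pd u₀ i y) i x|} A)
    (hB : IsLUB {a : ℝ | ∃ x ∈ closure Ω, ∃ v ∈ Icc (-M) M,
      a = |F x v (gradv u₀ x)|} B)
    (hK : K = A + B)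
    :
    ∀ t ∈ Icc 0 T, ∀ τ ∈ Icc 0 T, τ ≤ t → ∀ x ∈ closure Ω,
      u t x - u τ x ≤ K * (t - τ) := by
  have hdp : ∀ x ∈ Ω, ∀ i, DifferentiableAt ℝ (p i) x := fun x hx i =>
    ((hp i).1.contDiffAt (mem_of_superset (hΩo.mem_nhds hx) subset_closure)).differentiableAt
      (by simp)
  have hgrad : ∀ f g : EuclideanSpace ℝ (Fin n) → ℝ, ∀ x, (∀ i, pd f i x = pd g i x) →
      gradv f x = gradv g x := fun f g x h => by simp only [gradv, h]
  have hp1' : ∀ x ∈ Ω, ∀ i, -1 < p i x := fun x hx i => hp1 i x (subset_closure hx)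
  have hu₀at : ∀ x ∈ Ω, ContDiffAt ℝ 2 u₀ x := fun x hx =>
    hu₀.contDiffAt (hU.mem_nhds (hUΩ (subset_closure hx)))
  have hAle : ∀ x ∈ Ω,
      |∑ i, pd (fun y => ((pd u₀ i y) ^ 2 + ε) ^ (p i y / 2) * pd u₀ i y) i x| ≤ A :=
    fun x hx => hA.1 ⟨ε, ⟨hε.1.le, hε.2⟩, x, subset_closure hx, rfl⟩
  have hBle : ∀ x ∈ Ω, ∀ v ∈ Icc (-M) M, |F x v (gradv u₀ x)| ≤ B :=
    fun x hx v hv => hB.1 ⟨x, subset_closure hx, v, hv, rfl⟩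
  have hK0 : 0 ≤ K := by
    obtain ⟨x, hx⟩ := hΩconn.nonempty
    have h1 := (abs_nonneg _).trans (hAle x hx)
    have h2 := (abs_nonneg _).trans (hBle x hx 0 ⟨by linarith, hM.le⟩)
    linarith
  have hu₀c : ContinuousOn (fun q : ℝ × EuclideanSpace ℝ (Fin n) => u₀ q.2)
      (Icc 0 T ×ˢ closure Ω) :=
    (hu₀.continuousOn.mono hUΩ).comp continuousOn_snd fun q hq => hq.2
  have hstart : ∀ t ∈ Icc 0 T, ∀ x ∈ closure Ω, u t x - u₀ x - K * t ≤ 0 := by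
    have hder : ∀ t ∈ Ioo 0 T, ∀ x ∈ Ω, HasDerivAt (fun s => u s x - u₀ x - K * s)
        (deriv (fun s => u s x) t - K) t := fun t ht x hx => by
      simpa using ((hu.diff_t t ht x hx).hasDerivAt.sub_const (u₀ x)).fun_sub
        ((hasDerivAt_id t).const_mul K)
    refine le_of_parabolic_boundary_le (w := fun t x => u t x - u₀ x - K * t) hΩo hΩbd
      ((hu.cont.sub hu₀c).sub (by fun_prop))
      (fun t ht x hx => (hder t ht x hx).differentiableAt) ?_ ?_ ?_
    · intro x hx
      simp [hu.init x hx]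
    · intro t ht x hx
      have := mul_nonneg hK0 ht.1.le
      simp only [hu.bdry t ht x hx, hu₀ψ x hx]
      linarith
    · intro t ht x hx hmax _
      have hmax' : IsLocalMax (fun y => u t y - u₀ y) x := by
        filter_upwards [hmax] with y hy
        linarith
      have hux := hu.smooth_x t ht x hx
      have hle := sum_pd_flux_le_of_isLocalMax_sub hε.1 hux (hu₀at x hx) (hdp x hx)
        (hp1' x hx) hmax'
      rw [(hder t ht x hx).deriv, hu.eqn t ht x hx, hgrad (u t) u₀ x fun i =>
        pd_eq_of_isLocalMax_sub (hux.differentiableAt (by simp))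
          ((hu₀at x hx).differentiableAt (by simp)) hmax' i]
      have h1 := (abs_le.1 (hAle x hx)).2
      have h2 := (abs_le.1 (hBle x hx (u t x)
        (abs_le.1 (hub t ⟨ht.1.le, ht.2.le⟩ x (subset_closure hx))))).2
      linarith
  intro t ht τ hτ hτt x hx
  set h := t - τ with hh
  have hh0 : 0 ≤ h := sub_nonneg.2 hτt
  have hshift : ∀ s ∈ Ioo 0 (T - h), s ∈ Ioo 0 T ∧ s + h ∈ Ioo 0 T := fun s hs =>
    ⟨⟨hs.1, by linarith [hs.2]⟩, ⟨by linarith [hs.1], by linarith [hs.2]⟩⟩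
  have hder : ∀ s ∈ Ioo 0 (T - h), ∀ x ∈ Ω, HasDerivAt (fun r => u (r + h) x - u r x)
      (deriv (fun r => u r x) (s + h) - deriv (fun r => u r x) s) s := fun s hs x hx =>
    ((hu.diff_t _ (hshift s hs).2 x hx).hasDerivAt.comp_add_const s h).sub
      (hu.diff_t s (hshift s hs).1 x hx).hasDerivAt
  have hmain : ∀ s ∈ Icc 0 (T - h), ∀ x ∈ closure Ω, u (s + h) x - u s x ≤ K * h := by
    refine le_of_parabolic_boundary_le (w := fun s x => u (s + h) x - u s x) hΩo hΩbd
      (ContinuousOn.sub ?_ ?_) (fun s hs x hx => (hder s hs x hx).differentiableAt) ?_ ?_ ?_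
    · exact hu.cont.comp (f := fun q : ℝ × EuclideanSpace ℝ (Fin n) => (q.1 + h, q.2))
        (by fun_prop) fun q hq => ⟨⟨by linarith [hq.1.1], by linarith [hq.1.2]⟩, hq.2⟩
    · exact hu.cont.mono (prod_mono (Icc_subset_Icc_right (by linarith)) subset_rfl)
    · intro x hx
      have := hstart h ⟨hh0, by linarith [ht.2, hτ.1]⟩ x hx
      simp only [zero_add, hu.init x hx]
      linarith
    · intro s hs x hx
      simp only [hu.bdry s (hshift s hs).1 x hx, hu.bdry _ (hshift s hs).2 x hx, sub_self]
      exact mul_nonneg hK0 hh0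
    · intro s hs x hx hmax hlt
      have hux := hu.smooth_x s (hshift s hs).1 x hx
      have huxh := hu.smooth_x _ (hshift s hs).2 x hx
      have hle := sum_pd_flux_le_of_isLocalMax_sub hε.1 huxh hux (hdp x hx) (hp1' x hx) hmax
      rw [(hder s hs x hx).deriv, hu.eqn _ (hshift s hs).1 x hx, hu.eqn _ (hshift s hs).2 x hx,
        hgrad (u (s + h)) (u s) x fun i =>
          pd_eq_of_isLocalMax_sub (huxh.differentiableAt (by simp))
            (hux.differentiableAt (by simp)) hmax i]
      have hKh := mul_nonneg hK0 hh0
      have hFle := hFmono x (subset_closure hx) (u (s + h) x) (u s x) (gradv (u s) x)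
        (by linarith)
      linarith
  have hfin := hmain τ ⟨hτ.1, by linarith [ht.2]⟩ x hx
  rwa [show τ + h = t by rw [hh]; ring] at hfin
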